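/- arXiv:1909.00719 — 4 statements merged into one kernel-verified Lean document; each statement's English description precedes it below -/
import Mathlib

section
/- Let A ⊂ ℝ^D be a compact set, let g: A → ℝ be continuous, let h: A → ℝ be continuous and non-negative, and let ε > 0. Then there exists a 2-hidden-layer ReLU neural network f: ℝ^D → ℝ whose weights and biases are mutually independent Gaussian random variables (a fully-factorised Gaussian distribution over parameters) such that sup_{x ∈ A} |E[f(x)] − g(x)| < ε and sup_{x ∈ A} |Var[f(x)] − h(x)| < ε. -/
open MeasureTheory ProbabilityTheory Finset

/-- Index type for the parameters of a 2-hidden-layer network `ℝ^D → ℝ` with layer widths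
`I₁`, `I₂`: first-layer weights `(i, d)` and biases `i`, second-layer weights `(j, i)` and
biases `j`, output weights `j` and the output bias. -/
abbrev Param2Idx (D I₁ I₂ : ℕ) : Type :=
  (Fin I₁ × Fin D) ⊕ (Fin I₁ ⊕ ((Fin I₂ × Fin I₁) ⊕ (Fin I₂ ⊕ (Fin I₂ ⊕ Unit))))

/-- The output of the 2-hidden-layer ReLU network with parameters `θ` at input `x`. -/
def net2 {D I₁ I₂ : ℕ} (θ : Param2Idx D I₁ I₂ → ℝ) (x : Fin D → ℝ) : ℝ :=
  (∑ j : Fin I₂, θ (.inr (.inr (.inr (.inr (.inl j))))) *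
      max 0 ((∑ i : Fin I₁, θ (.inr (.inr (.inl (j, i)))) *
          max 0 ((∑ d, θ (.inl (i, d)) * x d) + θ (.inr (.inl i)))) +
        θ (.inr (.inr (.inr (.inl j)))))) +
    θ (.inr (.inr (.inr (.inr (.inr ())))))

/-- The one-hidden-layer ReLU networks on `ℝ^D` (without output bias), as a space of functions. -/
def shallowSpan (D : ℕ) : Submodule ℝ ((Fin D → ℝ) → ℝ) :=
  Submodule.span ℝ (Set.range fun (p : (Fin D → ℝ) × ℝ) (x : Fin D → ℝ) =>
    max 0 ((∑ d, p.1 d * x d) + p.2))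

lemma relu_mem_shallowSpan {D : ℕ} (a : Fin D → ℝ) (b : ℝ) :
    (fun x : Fin D → ℝ => max 0 ((∑ d, a d * x d) + b)) ∈ shallowSpan D :=
  Submodule.subset_span ⟨(a, b), rfl⟩

lemma const_mem_shallowSpan {D : ℕ} (c : ℝ) :
    (fun _ : Fin D → ℝ => c) ∈ shallowSpan D := by
  have h := (shallowSpan D).smul_mem c (relu_mem_shallowSpan (D := D) 0 1)
  convert h using 1
  ext x
  simp

/-- Linear interpolation on the grid `t₀ + k * δ`, realised by a one-hidden-layer network. -/
lemma exists_ridge_interpolant {D : ℕ} (a : Fin D → ℝ) (u : ℝ → ℝ) {t₀ δ ε : ℝ} (hδ : 0 < δ)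
    (n : ℕ)
    (hu : ∀ s ∈ Set.Icc t₀ (t₀ + n * δ), ∀ t ∈ Set.Icc t₀ (t₀ + n * δ),
      |s - t| ≤ δ → |u s - u t| ≤ ε) :
    ∃ p ∈ shallowSpan D,
      (∀ x, t₀ ≤ ∑ d, a d * x d → ∑ d, a d * x d ≤ t₀ + n * δ →
        |p x - u (∑ d, a d * x d)| ≤ ε) ∧
      ∀ x, t₀ + n * δ ≤ ∑ d, a d * x d → p x = u (t₀ + n * δ) := by
  induction n with
  | zero =>
    refine ⟨fun _ => u t₀, const_mem_shallowSpan _, fun x h1 h2 => ?_, fun x _ => by simp⟩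
    have h : ∑ d, a d * x d = t₀ := le_antisymm (by simpa using h2) h1
    have := hu t₀ (by simp) t₀ (by simp) (by simpa using hδ.le)
    simpa [h] using this
  | succ n ih =>
    have hn : (0 : ℝ) ≤ n * δ := by positivity
    push_cast at hu ⊢
    obtain ⟨p, hp, hp1, hp2⟩ := ih fun s hs t ht =>
      hu s ⟨hs.1, by linarith [hs.2]⟩ t ⟨ht.1, by linarith [ht.2]⟩
    set r := t₀ + n * δ with hr
    have hr' : t₀ + (n + 1) * δ = r + δ := by rw [hr]; ring
    rw [hr'] at hu ⊢
    refine ⟨p + ((u (r + δ) - u r) / δ) • ((fun x => max 0 ((∑ d, a d * x d) + -r)) -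
        fun x => max 0 ((∑ d, a d * x d) + -(r + δ))),
      add_mem hp (Submodule.smul_mem _ _ (sub_mem (relu_mem_shallowSpan _ _)
        (relu_mem_shallowSpan _ _))), fun x h1 h2 => ?_, fun x h => ?_⟩
    · simp only [Pi.add_apply, Pi.smul_apply, Pi.sub_apply, smul_eq_mul]
      rw [max_eq_left (b := (∑ d, a d * x d) + -(r + δ)) (by linarith), sub_zero]
      rcases le_total (∑ d, a d * x d) r with h | h
      · rw [max_eq_left (by linarith), mul_zero, add_zero]
        exact hp1 x h1 h
      · rw [max_eq_right (by linarith), hp2 x h]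
        set t := ∑ d, a d * x d
        have e1 := hu r ⟨by linarith, by linarith⟩ t ⟨h1, h2⟩
          (abs_le.2 ⟨by linarith, by linarith⟩)
        have e2 := hu (r + δ) ⟨by linarith, by linarith⟩ t ⟨h1, h2⟩
          (abs_le.2 ⟨by linarith, by linarith⟩)
        have hθ0 : 0 ≤ (t - r) / δ := div_nonneg (by linarith) hδ.le
        have hθ1 : (t - r) / δ ≤ 1 := (div_le_one hδ).2 (by linarith)
        have key : u r + (u (r + δ) - u r) / δ * (t + -r) - u t =
            (1 - (t - r) / δ) * (u r - u t) + (t - r) / δ * (u (r + δ) - u t) := by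
          field_simp
          ring
        rw [key]
        rw [abs_le] at e1 e2 ⊢
        constructor <;> nlinarith
    · simp only [Pi.add_apply, Pi.smul_apply, Pi.sub_apply, smul_eq_mul]
      rw [max_eq_right (by linarith), max_eq_right (by linarith), hp2 x (by linarith)]
      field_simp
      ring

/-- Continuous ridge functions are uniformly approximable by one-hidden-layer networks. -/
lemma exists_shallow_near_ridge {D : ℕ} {A : Set (Fin D → ℝ)} (hA : IsCompact A)
    (a : Fin D → ℝ) {u : ℝ → ℝ} (hu : Continuous u) {ε : ℝ} (hε : 0 < ε) :
    ∃ p ∈ shallowSpan D, ∀ x ∈ A, |p x - u (∑ d, a d * x d)| < ε := by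
  have hc : Continuous fun x : Fin D → ℝ => ∑ d, a d * x d := by fun_prop
  obtain ⟨M₀, hM₀⟩ := hA.exists_bound_of_continuousOn hc.continuousOn
  set M := max M₀ 1
  have hM : 0 < M := lt_of_lt_of_le one_pos (le_max_right _ _)
  have huc := isCompact_Icc.uniformContinuousOn_of_continuous
    (hu.continuousOn (s := Set.Icc (-M) M))
  obtain ⟨δ, hδ, hδu⟩ := Metric.uniformContinuousOn_iff.1 huc (ε / 2) (half_pos hε)
  obtain ⟨N, hN⟩ := exists_nat_gt (2 * M / δ)
  have hN0 : (0 : ℝ) < N := lt_trans (by positivity) hN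
  have hend : -M + N * (2 * M / N) = M := by
    field_simp
    ring
  have hlt : 2 * M / N < δ := by
    rw [div_lt_iff₀ hδ] at hN
    rw [div_lt_iff₀ hN0]
    linarith
  obtain ⟨p, hp, hp1, -⟩ := exists_ridge_interpolant a u (t₀ := -M) (δ := 2 * M / N)
    (ε := ε / 2) (by positivity) N (by
      rw [hend]
      intro s hs t ht hst
      exact (hδu s hs t ht (lt_of_le_of_lt hst hlt)).le)
  refine ⟨p, hp, fun x hx => ?_⟩
  have hx' := abs_le.1 ((hM₀ x hx).trans (le_max_left M₀ 1))
  exact lt_of_le_of_lt (hp1 x hx'.1 (hx'.2.trans hend.ge)) (half_lt_self hε)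

/-- The exponentials `x ↦ exp ⟨a, x⟩` on `A`, as a submonoid of `C(A, ℝ)`. -/
def expSubmonoid {D : ℕ} (A : Set (Fin D → ℝ)) : Submonoid C(A, ℝ) where
  carrier := {f | ∃ a : Fin D → ℝ, ∀ x : A, f x = Real.exp (∑ d, a d * x.1 d)}
  one_mem' := ⟨0, fun x => by simp⟩
  mul_mem' := by
    rintro f g ⟨a, ha⟩ ⟨b, hb⟩
    exact ⟨a + b, fun x => by
      simp [ha, hb, add_mul, Finset.sum_add_distrib, Real.exp_add]⟩

lemma separatesPoints_adjoin_expSubmonoid {D : ℕ} (A : Set (Fin D → ℝ)) :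
    (Algebra.adjoin ℝ (expSubmonoid A : Set C(A, ℝ))).SeparatesPoints := by
  intro x y hxy
  obtain ⟨d, hd⟩ : ∃ d, x.1 d ≠ y.1 d := by
    by_contra! h
    exact hxy (Subtype.ext (funext h))
  refine ⟨_, ⟨⟨fun z : A => Real.exp (∑ e, (Pi.single d 1 : Fin D → ℝ) e * z.1 e),
      Real.continuous_exp.comp (continuous_finsetSum _ fun e _ =>
        continuous_const.mul ((continuous_apply e).comp continuous_subtype_val))⟩,
    Algebra.subset_adjoin ⟨Pi.single d 1, fun z => rfl⟩, rfl⟩, ?_⟩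
  simpa [Pi.single_apply] using hd

/-- One-hidden-layer ReLU networks are dense in the continuous functions on a compact set. -/
lemma exists_shallow_near {D : ℕ} {A : Set (Fin D → ℝ)} (hA : IsCompact A)
    {g : (Fin D → ℝ) → ℝ} (hg : ContinuousOn g A) {ε : ℝ} (hε : 0 < ε) :
    ∃ p ∈ shallowSpan D, ∀ x ∈ A, |p x - g x| < ε := by
  have : CompactSpace A := isCompact_iff_compactSpace.1 hA
  obtain ⟨⟨f, hf⟩, hfg⟩ :=
    ContinuousMap.exists_mem_subalgebra_near_continuous_of_separatesPoints
      (Algebra.adjoin ℝ (expSubmonoid A : Set C(A, ℝ))) (separatesPoints_adjoin_expSubmonoid A)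
      (A.domRestrict g) hg.domRestrict (ε / 2) (half_pos hε)
  have hf' : f ∈ Submodule.span ℝ (expSubmonoid A : Set C(A, ℝ)) := by
    rwa [← Subalgebra.mem_toSubmodule, Algebra.adjoin_eq_span, Submonoid.closure_eq] at hf
  have happ : ∀ η : ℝ, 0 < η → ∃ p ∈ shallowSpan D, ∀ x : A, |p x - f x| < η := by
    clear hfg hf
    induction hf' using Submodule.span_induction with
    | mem f hf =>
      intro η hη
      obtain ⟨a, ha⟩ := hf
      obtain ⟨p, hp, hpe⟩ := exists_shallow_near_ridge hA a Real.continuous_exp hη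
      exact ⟨p, hp, fun x => by rw [ha]; exact hpe x x.2⟩
    | zero => exact fun η hη => ⟨0, zero_mem _, fun x => by simpa using hη⟩
    | add f₁ f₂ _ _ h₁ h₂ =>
      intro η hη
      obtain ⟨p, hp, hpe⟩ := h₁ (η / 2) (half_pos hη)
      obtain ⟨q, hq, hqe⟩ := h₂ (η / 2) (half_pos hη)
      refine ⟨p + q, add_mem hp hq, fun x => ?_⟩
      have h1 := abs_lt.1 (hpe x)
      have h2 := abs_lt.1 (hqe x)
      simp only [Pi.add_apply, ContinuousMap.add_apply]
      exact abs_lt.2 ⟨by linarith, by linarith⟩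
    | smul c f _ h =>
      intro η hη
      obtain ⟨p, hp, hpe⟩ := h (η / (|c| + 1)) (by positivity)
      refine ⟨c • p, Submodule.smul_mem _ _ hp, fun x => ?_⟩
      have h1 := hpe x
      rw [lt_div_iff₀ (by positivity)] at h1
      simp only [Pi.smul_apply, ContinuousMap.smul_apply, smul_eq_mul]
      rw [← mul_sub, abs_mul]
      nlinarith [abs_nonneg (p x - f x), abs_nonneg c]
  obtain ⟨p, hp, hpe⟩ := happ (ε / 2) (half_pos hε)
  refine ⟨p, hp, fun x hx => ?_⟩
  have h1 := abs_lt.1 (hpe ⟨x, hx⟩)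
  have h2 : _ ∧ f ⟨x, hx⟩ - g x < _ := abs_lt.1 (hfg ⟨x, hx⟩)
  exact abs_lt.2 ⟨by linarith, by linarith⟩

/-- Two one-hidden-layer networks can be written over a common hidden layer. -/
lemma exists_common_hidden_layer {D : ℕ} {p q : (Fin D → ℝ) → ℝ} (hp : p ∈ shallowSpan D)
    (hq : q ∈ shallowSpan D) :
    ∃ (I : ℕ) (W : Fin I → Fin D → ℝ) (b : Fin I → ℝ) (c : Fin 2 → Fin I → ℝ),
      (∀ x, ∑ i, c 0 i * max 0 ((∑ d, W i d * x d) + b i) = p x) ∧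
      ∀ x, ∑ i, c 1 i * max 0 ((∑ d, W i d * x d) + b i) = q x := by
  classical
  obtain ⟨k, rfl⟩ := Finsupp.mem_span_range_iff_exists_finsupp.1 hp
  obtain ⟨l, rfl⟩ := Finsupp.mem_span_range_iff_exists_finsupp.1 hq
  let T := k.support ∪ l.support
  let e := T.equivFin
  refine ⟨#T, fun i => (e.symm i).1.1, fun i => (e.symm i).1.2,
    ![fun i => k (e.symm i).1, fun i => l (e.symm i).1], fun x => ?_, fun x => ?_⟩
  · rw [Finsupp.sum_of_support_subset k (s := T) subset_union_left _ (by simp),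
      Finset.sum_apply, ← Finset.sum_coe_sort T]
    exact e.symm.sum_comp fun y : T => k y * max 0 ((∑ d, y.1.1 d * x d) + y.1.2)
  · rw [Finsupp.sum_of_support_subset l (s := T) subset_union_right _ (by simp),
      Finset.sum_apply, ← Finset.sum_coe_sort T]
    exact e.symm.sum_comp fun y : T => l y * max 0 ((∑ d, y.1.1 d * x d) + y.1.2)

/-- Mean and variance of a random variable that is affine in one coordinate once the degenerate
coordinates are set to their means. -/
lemma mean_variance_of_single_random {ι : Type*} [Fintype ι] [DecidableEq ι] (μ : ι → ℝ)
    (j₀ : ι) {F : (ι → ℝ) → ℝ} {s m : ℝ} (hF : ∀ t, F (Function.update μ j₀ t) = t * s + m) :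
    (∫ θ, F θ ∂(Measure.pi fun j => gaussianReal (μ j) ((Pi.single j₀ 1 : ι → NNReal) j))) = μ j₀ * s + m ∧
    variance F (Measure.pi fun j => gaussianReal (μ j) ((Pi.single j₀ 1 : ι → NNReal) j)) = s ^ 2 := by
  set P := Measure.pi fun j => gaussianReal (μ j) ((Pi.single j₀ 1 : ι → NNReal) j)
  have hev (j : ι) : MeasurePreserving (Function.eval j) P
      (gaussianReal (μ j) ((Pi.single j₀ 1 : ι → NNReal) j)) :=
    measurePreserving_eval _ j
  have hae : ∀ᵐ θ ∂P, ∀ j, j ≠ j₀ → θ j = μ j := by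
    rw [ae_all_iff]
    intro j
    by_cases hj : j = j₀
    · simp [hj]
    · have h : ∀ᵐ y ∂(gaussianReal (μ j) ((Pi.single j₀ 1 : ι → NNReal) j)), y = μ j := by
        rw [Pi.single_eq_of_ne hj, gaussianReal_zero_var]
        exact (ae_dirac_iff (measurableSet_singleton _)).2 rfl
      filter_upwards [(hev j).quasiMeasurePreserving.ae h] with θ hθ _ using hθ
  have hFae : F =ᵐ[P] fun θ => θ j₀ * s + m := by
    filter_upwards [hae] with θ hθ
    rw [← hF]
    congr 1
    ext j
    by_cases hj : j = j₀
    · subst hj; simp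
    · simp [hj, hθ j hj]
  have hev₀ := hev j₀
  rw [Pi.single_eq_same] at hev₀
  have hmem : MemLp (fun θ : ι → ℝ => θ j₀) 2 P :=
    (memLp_id_gaussianReal' (μ := μ j₀) (v := 1) 2 (by simp)).comp_measurePreserving hev₀
  have hint : Integrable (fun θ : ι → ℝ => θ j₀) P := hmem.integrable (by norm_num)
  constructor
  · rw [integral_congr_ae hFae, integral_add (hint.mul_const s) (integrable_const m),
      integral_mul_const]
    have h : ∫ θ, θ j₀ ∂P = μ j₀ := by
      have := integral_map (μ := P) (φ := Function.eval j₀) (f := fun y : ℝ => y)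
        (measurable_pi_apply j₀).aemeasurable (by fun_prop)
      rw [hev₀.map_eq, integral_id_gaussianReal] at this
      exact this.symm
    simp [h]
  · rw [variance_congr hFae, variance_add_const (hint.mul_const s).aestronglyMeasurable,
      variance_mul_const]
    have h : variance (fun θ : ι → ℝ => θ j₀) P = 1 := by
      have := variance_map (μ := P) (Y := Function.eval j₀) (X := fun y : ℝ => y)
        (by fun_prop) (measurable_pi_apply j₀).aemeasurable
      rw [hev₀.map_eq] at this
      exact this.symm.trans (by simp)
    rw [h]
    ring

lemma abs_sq_max_sub_lt {p s K ε : ℝ} (hs : 0 ≤ s) (hsK : s ≤ K)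
    (hp : |p - s| < min 1 (ε / (2 * K + 2))) : |max 0 p ^ 2 - s ^ 2| < ε := by
  have hr : |max 0 p - s| ≤ |p - s| := by
    have := abs_max_sub_max_le_abs p s 0
    rwa [max_eq_left hs, max_comm] at this
  have h1 := hp.trans_le (min_le_left _ _)
  have h2 := hp.trans_le (min_le_right _ _)
  rw [lt_div_iff₀ (by linarith)] at h2
  have hb : |max 0 p + s| ≤ 2 * K + 1 := by
    rw [abs_of_nonneg (by positivity)]
    linarith [abs_lt.1 (hr.trans_lt h1)]
  rw [sq_sub_sq, abs_mul]
  nlinarith [mul_le_mul hb hr (abs_nonneg _) (by linarith), abs_nonneg (p - s)]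

/-- **universality for mean-field Gaussians.** For every compact `A ⊆ ℝ^D`,
continuous `g : A → ℝ`, continuous non-negative `h : A → ℝ`, and `ε > 0`, there is a
2-hidden-layer ReLU network whose parameters are mutually independent Gaussians (a
fully-factorised Gaussian distribution over the parameters) such that
`|E[f(x)] − g(x)| < ε` and `|Var[f(x)] − h(x)| < ε` for all `x ∈ A`. -/
theorem ffg_universal_mean_variance (D : ℕ) (A : Set (Fin D → ℝ)) (hA : IsCompact A)
    (g h : (Fin D → ℝ) → ℝ) (hg : ContinuousOn g A) (hh : ContinuousOn h A)
    (hh0 : ∀ x ∈ A, 0 ≤ h x) (ε : ℝ) (hε : 0 < ε) :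
    ∃ (I₁ I₂ : ℕ) (μ : Param2Idx D I₁ I₂ → ℝ) (σ : Param2Idx D I₁ I₂ → NNReal),
      ∀ x ∈ A,
        |(∫ θ, net2 θ x ∂(Measure.pi fun j => gaussianReal (μ j) (σ j))) - g x| < ε ∧
        |variance (fun θ => net2 θ x) (Measure.pi fun j => gaussianReal (μ j) (σ j)) - h x|
          < ε := by
  have hcont : ContinuousOn (fun x => √(h x)) A := Real.continuous_sqrt.comp_continuousOn hh
  obtain ⟨K, hK⟩ := hA.exists_bound_of_continuousOn hcont
  obtain ⟨C, hC⟩ := hA.exists_bound_of_continuousOn hg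
  obtain ⟨p, hp, hpe⟩ := exists_shallow_near hA hcont
    (ε := min 1 (ε / (2 * max K 0 + 2))) (by positivity)
  obtain ⟨q, hq, hqe⟩ := exists_shallow_near hA hg hε
  obtain ⟨I, W, b, c, hc0, hc1⟩ := exists_common_hidden_layer hp hq
  let μ : Param2Idx D I 2 → ℝ := Sum.elim (fun k => W k.1 k.2) <| Sum.elim b <|
    Sum.elim (fun k => c k.1 k.2) <| Sum.elim ![0, C + ε] <| Sum.elim ![0, 1] fun _ => -(C + ε)
  let j₀ : Param2Idx D I 2 := .inr (.inr (.inr (.inr (.inl 0))))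
  refine ⟨I, 2, μ, Pi.single j₀ 1, fun x hx => ?_⟩
  have hgx := abs_le.1 (hC x hx)
  have hqx := abs_lt.1 (hqe x hx)
  have hF (t : ℝ) : net2 (Function.update μ j₀ t) x = t * max 0 (p x) + q x := by
    have h1 : max 0 (q x + (C + ε)) = q x + (C + ε) := max_eq_right (by linarith)
    simp only [net2, Fin.sum_univ_two]
    simp [μ, j₀, hc0, hc1, h1]
    ring
  obtain ⟨hmean, hvar⟩ := mean_variance_of_single_random μ j₀ (F := fun θ => net2 θ x) hF
  rw [hmean, hvar]
  constructor
  · simpa [μ, j₀] using hqe x hx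
  · have hsx : √(h x) ≤ max K 0 := (le_abs_self _).trans ((hK x hx).trans (le_max_left _ _))
    have := abs_sq_max_sub_lt (Real.sqrt_nonneg _) hsx (hpe x hx)
    rwa [Real.sq_sqrt (hh0 x hx)] at this
end

section
/- For each x ∈ ℝ let a(x) be a Gaussian random variable with mean μ(x) = μ_u x + μ_v and variance σ²(x) = σ_u² x² + σ_v², where μ_u, μ_v ∈ ℝ and σ_u, σ_v > 0. If μ_u ≥ 0 then the function x ↦ Var[ψ(a(x))] belongs to T1; if μ_u ≤ 0 then it belongs to T2. -/
open MeasureTheory ProbabilityTheory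

/-- `T1`: non-negative functions `f : ℝ → [0,∞)` such that for all `0 ≤ b < a`,
`f (-a) ≤ f a` and `f b ≤ f a`. -/
def MemT1 (f : ℝ → ℝ) : Prop :=
  (∀ x, 0 ≤ f x) ∧ ∀ a b : ℝ, 0 ≤ b → b < a → f (-a) ≤ f a ∧ f b ≤ f a

/-- `T2`: non-negative functions `f : ℝ → [0,∞)` such that for all `a < b ≤ 0`,
`f (-a) ≤ f a` and `f b ≤ f a`. -/
def MemT2 (f : ℝ → ℝ) : Prop :=
  (∀ x, 0 ≤ f x) ∧ ∀ a b : ℝ, b ≤ 0 → a < b → f (-a) ≤ f a ∧ f b ≤ f a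

lemma abs_max_affine_sub_le_of_le {m n s : ℝ} (hmn : m ≤ n) (hs : 0 ≤ s) (z w : ℝ) :
    |max 0 (m + s * z) - max 0 (m + s * w)| ≤ |max 0 (n + s * z) - max 0 (n + s * w)| := by
  wlog hwz : w ≤ z generalizing z w
  · rw [abs_sub_comm, abs_sub_comm (max 0 (n + s * z))]
    exact this w z (le_of_not_ge hwz)
  have h := mul_le_mul_of_nonneg_left hwz hs
  rw [abs_of_nonneg (by grind), abs_of_nonneg (by grind)]
  grind

lemma max_mul_sub_le_of_le {m s t z w : ℝ} (hs : 0 ≤ s) (hst : s ≤ t)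
    (hw : 0 ≤ w) (hwz : w ≤ z) :
    max m (s * z) - max m (s * w) ≤ max m (t * z) - max m (t * w) := by
  have h1 := mul_le_mul_of_nonneg_left hwz hs
  have h2 := mul_le_mul_of_nonneg_right hst hw
  have h3 := mul_nonneg (sub_nonneg.2 hst) (sub_nonneg.2 hwz)
  have h4 := mul_le_mul_of_nonneg_right hst (hw.trans hwz)
  have h5 : s * z - s * w ≤ t * z - t * w := by nlinarith
  grind

lemma max_zero_affine_eq {m r : ℝ} (hm : m ≤ 0) (hr : 0 ≤ r) (y : ℝ) :
    max 0 (m + r * y) = m + max (-m) (r * max 0 y) := by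
  rcases le_total 0 y with h | h
  · rw [max_eq_right h]; grind
  · have := mul_nonpos_of_nonneg_of_nonpos hr h
    rw [max_eq_left h, mul_zero]; grind

lemma abs_max_affine_sub_le_of_slope_le {m s t : ℝ} (hm : m ≤ 0) (hs : 0 ≤ s) (hst : s ≤ t)
    (z w : ℝ) :
    |max 0 (m + s * z) - max 0 (m + s * w)| ≤ |max 0 (m + t * z) - max 0 (m + t * w)| := by
  wlog hwz : w ≤ z generalizing z w
  · rw [abs_sub_comm, abs_sub_comm (max 0 (m + t * z))]
    exact this w z (le_of_not_ge hwz)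
  have ht := hs.trans hst
  have h1 := mul_le_mul_of_nonneg_left hwz hs
  have h2 := mul_le_mul_of_nonneg_left hwz ht
  rw [abs_of_nonneg (by grind), abs_of_nonneg (by grind), max_zero_affine_eq hm hs,
    max_zero_affine_eq hm hs, max_zero_affine_eq hm ht, max_zero_affine_eq hm ht]
  have := max_mul_sub_le_of_le (m := -m) hs hst (le_max_left 0 w) (max_le_max_left 0 hwz)
  linarith

/-- The sum of the squared increments of `f` over the four pairs `(±z, ±w)`. -/
def signedSqIncrements (f : ℝ → ℝ) (z w : ℝ) : ℝ :=
  (f z - f w) ^ 2 + (f z - f (-w)) ^ 2 + (f (-z) - f w) ^ 2 + (f (-z) - f (-w)) ^ 2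

lemma signedSqIncrements_le_of_abs_sub_le {f g : ℝ → ℝ}
    (h : ∀ z w, |f z - f w| ≤ |g z - g w|) (z w : ℝ) :
    signedSqIncrements f z w ≤ signedSqIncrements g z w := by
  have h' : ∀ z w, (f z - f w) ^ 2 ≤ (g z - g w) ^ 2 := fun z w => sq_le_sq.2 (h z w)
  unfold signedSqIncrements
  linarith [h' z w, h' z (-w), h' (-z) w, h' (-z) (-w)]

lemma signedSqIncrements_max_affine_le_of_slope_le_of_nonneg {m s t : ℝ} (hm : 0 ≤ m)
    (hs : 0 ≤ s) (hst : s ≤ t) (z w : ℝ) :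
    signedSqIncrements (fun x => max 0 (m + s * x)) z w ≤
      signedSqIncrements (fun x => max 0 (m + t * x)) z w := by
  have ht := hs.trans hst
  wlog hz : 0 ≤ z generalizing z
  · have := this (-z) (by linarith)
    simp only [signedSqIncrements, neg_neg] at this ⊢
    linarith
  wlog hw : 0 ≤ w generalizing w
  · have := this (-w) (by linarith)
    simp only [signedSqIncrements, neg_neg] at this ⊢
    linarith
  have decomp : ∀ f : ℝ → ℝ, signedSqIncrements f z w =
      ((f z + f (-z)) - (f w + f (-w))) ^ 2 + (f z - f (-z)) ^ 2 + (f w - f (-w)) ^ 2 :=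
    fun f => by unfold signedSqIncrements; ring
  have even : ∀ r y : ℝ, 0 ≤ r → 0 ≤ y →
      max 0 (m + r * y) + max 0 (m + r * (-y)) = m + max m (r * y) := fun r y hr hy => by
    have := mul_nonneg hr hy
    rw [mul_neg]; grind
  have odd : ∀ r y : ℝ, 0 ≤ r → 0 ≤ y →
      max 0 (m + r * y) - max 0 (m + r * (-y)) = min (2 * (r * y)) (m + r * y) :=
    fun r y hr hy => by
      have := mul_nonneg hr hy
      rw [mul_neg]; grind
  have oddSq : ∀ y : ℝ, 0 ≤ y →
      (min (2 * (s * y)) (m + s * y)) ^ 2 ≤ (min (2 * (t * y)) (m + t * y)) ^ 2 := fun y hy => by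
    have h1 := mul_nonneg hs hy
    have h2 := mul_le_mul_of_nonneg_right hst hy
    exact pow_le_pow_left₀ (by grind) (by grind) 2
  have evenSq : ∀ y x : ℝ, 0 ≤ x → x ≤ y →
      (m + max m (s * y) - (m + max m (s * x))) ^ 2 ≤
        (m + max m (t * y) - (m + max m (t * x))) ^ 2 := fun y x hx hxy => by
    have h1 := mul_le_mul_of_nonneg_left hxy hs
    have h2 := max_mul_sub_le_of_le (m := m) hs hst hx hxy
    exact pow_le_pow_left₀ (by grind) (by linarith) 2
  rw [decomp, decomp, even s z hs hz, even s w hs hw, even t z ht hz, even t w ht hw,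
    odd s z hs hz, odd s w hs hw, odd t z ht hz, odd t w ht hw]
  have h3 := oddSq z hz
  have h4 := oddSq w hw
  rcases le_total w z with h | h
  · linarith [evenSq z w hw h]
  · linarith [evenSq w z hz h]

lemma signedSqIncrements_max_affine_mono {m n s t : ℝ} (hmn : m ≤ n) (hs : 0 ≤ s) (hst : s ≤ t)
    (z w : ℝ) :
    signedSqIncrements (fun x => max 0 (m + s * x)) z w ≤
      signedSqIncrements (fun x => max 0 (n + t * x)) z w := by
  refine (?_ : _ ≤ signedSqIncrements (fun x => max 0 (m + t * x)) z w).trans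
    (signedSqIncrements_le_of_abs_sub_le
      (abs_max_affine_sub_le_of_le hmn (hs.trans hst)) z w)
  rcases le_total 0 m with hm | hm
  · exact signedSqIncrements_max_affine_le_of_slope_le_of_nonneg hm hs hst z w
  · exact signedSqIncrements_le_of_abs_sub_le (abs_max_affine_sub_le_of_slope_le hm hs hst) z w

section Variance

variable {P : Measure ℝ} [IsProbabilityMeasure P]

lemma integrable_sq_sub_prod {f g : ℝ → ℝ} (hf : MemLp f 2 P) (hg : MemLp g 2 P) :
    Integrable (fun p : ℝ × ℝ => (f p.1 - g p.2) ^ 2) (P.prod P) :=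
  ((hf.comp_fst P).sub (hg.comp_snd P)).integrable_sq

lemma integral_sq_sub_prod {f g : ℝ → ℝ} (hf : MemLp f 2 P) (hg : MemLp g 2 P) :
    ∫ p : ℝ × ℝ, (f p.1 - g p.2) ^ 2 ∂(P.prod P) =
      (∫ x, f x ^ 2 ∂P) + (∫ x, g x ^ 2 ∂P) - 2 * ((∫ x, f x ∂P) * ∫ x, g x ∂P) := by
  have h1 : Integrable (fun p : ℝ × ℝ => f p.1 ^ 2) (P.prod P) := (hf.comp_fst P).integrable_sq
  have h2 : Integrable (fun p : ℝ × ℝ => g p.2 ^ 2) (P.prod P) := (hg.comp_snd P).integrable_sq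
  have h3 : Integrable (fun p : ℝ × ℝ => f p.1 * g p.2) (P.prod P) :=
    (hf.integrable one_le_two).mul_prod (hg.integrable one_le_two)
  have e : ∀ p : ℝ × ℝ, (f p.1 - g p.2) ^ 2 = f p.1 ^ 2 + g p.2 ^ 2 - 2 * (f p.1 * g p.2) :=
    fun p => by ring
  simp_rw [e]
  have h12 : Integrable (fun p : ℝ × ℝ => f p.1 ^ 2 + g p.2 ^ 2) (P.prod P) := h1.add h2
  rw [integral_sub h12 (h3.const_mul 2), integral_add h1 h2, integral_const_mul,
    integral_prod_mul, integral_fun_fst (fun x => f x ^ 2), integral_fun_snd (fun x => g x ^ 2)]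
  simp

lemma integrable_signedSqIncrements (hP : MeasurePreserving Neg.neg P P) {f : ℝ → ℝ}
    (hf : MemLp f 2 P) :
    Integrable (fun p : ℝ × ℝ => signedSqIncrements f p.1 p.2) (P.prod P) := by
  have hf' : MemLp (fun x => f (-x)) 2 P := hf.comp_measurePreserving hP
  exact (((integrable_sq_sub_prod hf hf).add (integrable_sq_sub_prod hf hf')).add
    (integrable_sq_sub_prod hf' hf)).add (integrable_sq_sub_prod hf' hf')

lemma integral_signedSqIncrements (hP : MeasurePreserving Neg.neg P P) {f : ℝ → ℝ}
    (hf : MemLp f 2 P) :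
    ∫ p : ℝ × ℝ, signedSqIncrements f p.1 p.2 ∂(P.prod P) = 8 * variance f P := by
  have hf' : MemLp (fun x => f (-x)) 2 P := hf.comp_measurePreserving hP
  have i1 := integrable_sq_sub_prod hf hf
  have i2 := integrable_sq_sub_prod hf hf'
  have i3 := integrable_sq_sub_prod hf' hf
  have i4 := integrable_sq_sub_prod hf' hf'
  have hneg : ∀ g : ℝ → ℝ, ∫ x, g (-x) ∂P = ∫ x, g x ∂P :=
    fun g => hP.integral_comp (MeasurableEquiv.neg ℝ).measurableEmbedding g
  have i12 : Integrable (fun p : ℝ × ℝ =>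
    (f p.1 - f p.2) ^ 2 + (f p.1 - f (-p.2)) ^ 2) (P.prod P) := i1.add i2
  have i123 : Integrable (fun p : ℝ × ℝ => (f p.1 - f p.2) ^ 2 + (f p.1 - f (-p.2)) ^ 2 +
    (f (-p.1) - f p.2) ^ 2) (P.prod P) := i12.add i3
  unfold signedSqIncrements
  rw [integral_add i123 i4, integral_add i12 i3, integral_add i1 i2,
    integral_sq_sub_prod hf hf, integral_sq_sub_prod hf hf', integral_sq_sub_prod hf' hf,
    integral_sq_sub_prod hf' hf', hneg f, hneg (fun x => f x ^ 2), variance_eq_sub hf]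
  simp only [Pi.pow_apply]
  ring

lemma variance_le_of_signedSqIncrements_le (hP : MeasurePreserving Neg.neg P P) {f g : ℝ → ℝ}
    (hf : MemLp f 2 P) (hg : MemLp g 2 P)
    (h : ∀ z w, signedSqIncrements f z w ≤ signedSqIncrements g z w) :
    variance f P ≤ variance g P := by
  have := integral_mono (integrable_signedSqIncrements hP hf)
    (integrable_signedSqIncrements hP hg) fun p => h p.1 p.2
  simp only [integral_signedSqIncrements hP hf, integral_signedSqIncrements hP hg] at this
  linarith

end Variance

lemma gaussianReal_eq_map_affine (m v : ℝ) (hv : 0 ≤ v) :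
    gaussianReal m v.toNNReal = (gaussianReal 0 1).map (fun z => m + √v * z) := by
  have h : (fun z => m + √v * z) = (fun z => m + z) ∘ (fun z => √v * z) := rfl
  rw [h, ← Measure.map_map (by fun_prop) (by fun_prop), gaussianReal_map_const_mul,
    gaussianReal_map_const_add]
  congr 1
  · simp
  · ext
    simp [hv]

lemma variance_max_gaussianReal_mono {m n v w : ℝ} (hmn : m ≤ n) (hv : 0 ≤ v) (hvw : v ≤ w) :
    variance (fun y => max 0 y) (gaussianReal m v.toNNReal) ≤
      variance (fun y => max 0 y) (gaussianReal n w.toNNReal) := by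
  have hmeas : Measurable fun y : ℝ => max 0 y := by fun_prop
  have hP : MeasurePreserving Neg.neg (gaussianReal 0 1) (gaussianReal 0 1) :=
    ⟨measurable_neg, by simpa using gaussianReal_map_neg (μ := 0) (v := 1)⟩
  have hL : ∀ m s : ℝ, MemLp (fun z => max 0 (m + s * z)) 2 (gaussianReal 0 1) := fun m s => by
    have h : MemLp (fun z : ℝ => m + s * z) 2 (gaussianReal 0 1) :=
      (memLp_const m).add ((memLp_id_gaussianReal 2).const_mul s)
    refine h.mono (by fun_prop) (.of_forall fun z => ?_)
    simp only [Real.norm_eq_abs]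
    grind
  rw [gaussianReal_eq_map_affine m v hv, gaussianReal_eq_map_affine n w (hv.trans hvw),
    variance_map hmeas.aemeasurable (by fun_prop), variance_map hmeas.aemeasurable (by fun_prop)]
  exact variance_le_of_signedSqIncrements_le hP (hL m _) (hL n _)
    (signedSqIncrements_max_affine_mono hmn (Real.sqrt_nonneg v) (Real.sqrt_le_sqrt hvw))

/-- For each `x`, let `a x` be Gaussian with mean `μ_u x + μ_v` and
variance `σ_u² x² + σ_v²` (`σ_u, σ_v > 0`).  If `μ_u ≥ 0` then `x ↦ Var[ψ(a(x))]` lies in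
`T1`; if `μ_u ≤ 0` it lies in `T2`, where `ψ = max 0`. -/
theorem neuron_variance_memT1T2 {Ω : Type*} [MeasureSpace Ω]
    [IsProbabilityMeasure (ℙ : Measure Ω)]
    (μu μv σu σv : ℝ) (hσu : 0 < σu) (hσv : 0 < σv)
    (a : ℝ → Ω → ℝ)
    (ha : ∀ x : ℝ, Measure.map (a x) ℙ =
      gaussianReal (μu * x + μv) (Real.toNNReal (σu ^ 2 * x ^ 2 + σv ^ 2))) :
    (0 ≤ μu → MemT1 (fun x => variance (fun ω => max 0 (a x ω)) ℙ)) ∧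
      (μu ≤ 0 → MemT2 (fun x => variance (fun ω => max 0 (a x ω)) ℙ)) := by
  have hvar : ∀ x, variance (fun ω => max 0 (a x ω)) ℙ = variance (fun y => max 0 y)
      (gaussianReal (μu * x + μv) (σu ^ 2 * x ^ 2 + σv ^ 2).toNNReal) := fun x => by
    have hmeas : Measurable fun y : ℝ => max 0 y := by fun_prop
    have hax : AEMeasurable (a x) ℙ := AEMeasurable.of_map_ne_zero (by
      rw [ha x]; exact IsProbabilityMeasure.ne_zero _)
    rw [← ha x, variance_map hmeas.aemeasurable hax]
    rfl
  have hmono : ∀ x y, μu * x ≤ μu * y → x ^ 2 ≤ y ^ 2 →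
      variance (fun ω => max 0 (a x ω)) ℙ ≤ variance (fun ω => max 0 (a y ω)) ℙ :=
    fun x y h1 h2 => by
      rw [hvar, hvar]
      exact variance_max_gaussianReal_mono (by linarith) (by positivity) (by gcongr)
  refine ⟨fun hμ => ⟨fun x => variance_nonneg _ _, fun x y hy hyx => ⟨?_, ?_⟩⟩,
    fun hμ => ⟨fun x => variance_nonneg _ _, fun x y hy hxy => ⟨?_, ?_⟩⟩⟩
  · exact hmono _ _ (mul_le_mul_of_nonneg_left (by linarith) hμ) (by simp)
  · exact hmono _ _ (mul_le_mul_of_nonneg_left hyx.le hμ) (by nlinarith)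
  · exact hmono _ _ (mul_le_mul_of_nonpos_left (by linarith) hμ) (by simp)
  · exact hmono _ _ (mul_le_mul_of_nonpos_left hxy.le hμ) (by nlinarith)
end

section
/- Let A ⊂ ℝ^D be a compact set and let f_θ be a single-hidden layer ReLU neural network from ℝ^D to ℝ^K whose parameters θ = (U, v, W, b) are mutually independent Gaussian random variables with fixed means μ and with every standard deviation equal to a shared constant σ > 0. For any fixed μ and any ε > 0, there exists σ' > 0 such that for all 0 < σ < σ' and all x ∈ A, Var[ψ(f^(k)_θ(x))] < ε for every 1 ≤ k ≤ K. -/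
open MeasureTheory ProbabilityTheory Finset

/-- Index type for the parameters of a single-hidden-layer network `ℝ^D → ℝ^K` with `I`
hidden units: input weights `(i, d)`, input biases `i`, output weights `(k, i)`, output
biases `k`. -/
abbrev ParamIdx (D I K : ℕ) : Type := (Fin I × Fin D) ⊕ (Fin I ⊕ ((Fin K × Fin I) ⊕ Fin K))

/-- The `k`-th output of the single-hidden-layer ReLU network with parameters `θ`. -/
def net1 {D I K : ℕ} (θ : ParamIdx D I K → ℝ) (x : Fin D → ℝ) (k : Fin K) : ℝ :=
  (∑ i, θ (.inr (.inr (.inl (k, i)))) *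
      max 0 ((∑ d, θ (.inl (i, d)) * x d) + θ (.inr (.inl i)))) +
    θ (.inr (.inr (.inr k)))

/-- The fully-factorised Gaussian distribution over the parameters, with means `μ` and a
shared standard deviation `σ` for every parameter. -/
noncomputable def gaussParams {D I K : ℕ} (μ : ParamIdx D I K → ℝ) (σ : ℝ) :
    Measure (ParamIdx D I K → ℝ) :=
  Measure.pi fun j => gaussianReal (μ j) (Real.toNNReal (σ ^ 2))

lemma abs_max_zero_sub_max_zero_le (a b : ℝ) : |max 0 a - max 0 b| ≤ |a - b| := by
  simpa using abs_max_sub_max_le_max 0 a 0 b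

/-- Each preactivation changes by at most `(R + 1)` times the `ℓ¹` distance of the parameters. -/
lemma abs_preactivation_sub_le {D I K : ℕ} (θ θ' : ParamIdx D I K → ℝ) (x : Fin D → ℝ)
    {R : ℝ} (hR : 0 ≤ R) (hx : ∀ d, |x d| ≤ R) (i : Fin I) :
    |((∑ d, θ (.inl (i, d)) * x d) + θ (.inr (.inl i))) -
      ((∑ d, θ' (.inl (i, d)) * x d) + θ' (.inr (.inl i)))| ≤
      (R + 1) * ∑ j, |θ j - θ' j| := by
  have hv : |θ (.inr (.inl i)) - θ' (.inr (.inl i))| ≤ ∑ j, |θ j - θ' j| :=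
    Finset.single_le_sum (f := fun j => |θ j - θ' j|) (fun _ _ => abs_nonneg _)
      (Finset.mem_univ _)
  have hu : ∑ d, |θ (.inl (i, d)) - θ' (.inl (i, d))| ≤ ∑ j, |θ j - θ' j| := by
    have := Finset.sum_le_sum_of_subset_of_nonneg
      (f := fun j : ParamIdx D I K => |θ j - θ' j|)
      (Finset.subset_univ ((Finset.univ : Finset (Fin D)).map
        ⟨fun d => (.inl (i, d) : ParamIdx D I K), fun a b h => by simpa using h⟩))
      (fun _ _ _ => abs_nonneg _)
    rw [Finset.sum_map] at this
    exact this
  have hsum : |∑ d, (θ (.inl (i, d)) - θ' (.inl (i, d))) * x d| ≤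
      R * ∑ d, |θ (.inl (i, d)) - θ' (.inl (i, d))| := by
    refine (Finset.abs_sum_le_sum_abs _ _).trans ?_
    rw [Finset.mul_sum]
    refine Finset.sum_le_sum fun d _ => ?_
    rw [abs_mul, mul_comm]
    exact mul_le_mul_of_nonneg_right (hx d) (abs_nonneg _)
  have heq : ((∑ d, θ (.inl (i, d)) * x d) + θ (.inr (.inl i))) -
      ((∑ d, θ' (.inl (i, d)) * x d) + θ' (.inr (.inl i))) =
      (∑ d, (θ (.inl (i, d)) - θ' (.inl (i, d))) * x d) +
        (θ (.inr (.inl i)) - θ' (.inr (.inl i))) := by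
    simp only [sub_mul, Finset.sum_sub_distrib]
    ring
  rw [heq]
  refine (abs_add_le _ _).trans ?_
  have := mul_le_mul_of_nonneg_left hu hR
  linarith

/-- The network output is locally Lipschitz in the parameters, uniformly for bounded inputs. -/
lemma abs_net1_sub_le {D I K : ℕ} (θ θ' : ParamIdx D I K → ℝ) (x : Fin D → ℝ)
    {R : ℝ} (hR : 0 ≤ R) (hx : ∀ d, |x d| ≤ R) (k : Fin K) :
    |net1 θ x k - net1 θ' x k| ≤
      (∑ j, |θ j - θ' j|) *
        (I * ((R + 1) * (2 * (∑ j, |θ' j|) + ∑ j, |θ j - θ' j|)) + 1) := by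
  have hsingle : ∀ j, |θ j - θ' j| ≤ ∑ j, |θ j - θ' j| := fun j =>
    Finset.single_le_sum (f := fun j => |θ j - θ' j|) (fun _ _ => abs_nonneg _)
      (Finset.mem_univ _)
  have hsingle' : ∀ j, |θ' j| ≤ ∑ j, |θ' j| := fun j =>
    Finset.single_le_sum (f := fun j => |θ' j|) (fun _ _ => abs_nonneg _)
      (Finset.mem_univ _)
  have hpre := abs_preactivation_sub_le θ θ' x hR hx
  have hpre' : ∀ i, |(∑ d, θ' (.inl (i, d)) * x d) + θ' (.inr (.inl i))| ≤
      (R + 1) * ∑ j, |θ' j| := fun i => by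
    simpa using abs_preactivation_sub_le θ' 0 x hR hx i
  have hδ : 0 ≤ ∑ j, |θ j - θ' j| := Finset.sum_nonneg fun _ _ => abs_nonneg _
  have hM : 0 ≤ ∑ j, |θ' j| := Finset.sum_nonneg fun _ _ => abs_nonneg _
  unfold net1
  generalize ∑ j, |θ j - θ' j| = δ at *
  generalize ∑ j, |θ' j| = M at *
  have hterm : ∀ i : Fin I,
      |θ (.inr (.inr (.inl (k, i)))) *
          max 0 ((∑ d, θ (.inl (i, d)) * x d) + θ (.inr (.inl i))) -
        θ' (.inr (.inr (.inl (k, i)))) *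
          max 0 ((∑ d, θ' (.inl (i, d)) * x d) + θ' (.inr (.inl i)))| ≤
        δ * ((R + 1) * (2 * M + δ)) := fun i => by
    have h1 := hpre i
    have h2 := hpre' i
    have h3 := hsingle (.inr (.inr (.inl (k, i))))
    have h4 := hsingle' (.inr (.inr (.inl (k, i))))
    generalize (∑ d, θ (.inl (i, d)) * x d) + θ (.inr (.inl i)) = a at *
    generalize (∑ d, θ' (.inl (i, d)) * x d) + θ' (.inr (.inl i)) = a' at *
    generalize θ (.inr (.inr (.inl (k, i)))) = w at *
    generalize θ' (.inr (.inr (.inl (k, i)))) = w' at *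
    have h5 : |max 0 a - max 0 a'| ≤ (R + 1) * δ :=
      (abs_max_zero_sub_max_zero_le a a').trans h1
    have h6 : |max 0 a| ≤ (R + 1) * (M + δ) := by
      have h0 : |max 0 a'| ≤ |a'| := by simpa using abs_max_zero_sub_max_zero_le a' 0
      have := abs_sub_abs_le_abs_sub (max 0 a) (max 0 a')
      linarith
    have heq : w * max 0 a - w' * max 0 a' =
        (w - w') * max 0 a + w' * (max 0 a - max 0 a') := by ring
    rw [heq]
    refine (abs_add_le _ _).trans ?_
    rw [abs_mul, abs_mul]
    have h7 := mul_le_mul h3 h6 (abs_nonneg _) hδ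
    have h8 := mul_le_mul h4 h5 (abs_nonneg _) hM
    linarith
  rw [add_sub_add_comm, ← Finset.sum_sub_distrib]
  refine (abs_add_le _ _).trans ?_
  have hb := hsingle (.inr (.inr (.inr k)))
  have hs := (Finset.abs_sum_le_sum_abs _ _).trans
    (Finset.sum_le_sum fun i (_ : i ∈ Finset.univ) => hterm i)
  simp only [Finset.sum_const, Finset.card_univ, Fintype.card_fin, nsmul_eq_mul] at hs
  linarith

lemma gaussParams_eq_map {D I K : ℕ} (μ : ParamIdx D I K → ℝ) (σ : ℝ) :
    gaussParams μ σ =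
      (Measure.pi fun _ : ParamIdx D I K => gaussianReal 0 1).map
        (fun z j => σ * z j + μ j) := by
  have h : ∀ j, gaussianReal (μ j) (Real.toNNReal (σ ^ 2)) =
      (gaussianReal 0 1).map (fun t => σ * t + μ j) := fun j => by
    have := Measure.map_map (μ := gaussianReal 0 1) (g := fun t => t + μ j)
      (f := fun t => σ * t) (by fun_prop) (by fun_prop)
    rw [gaussianReal_map_const_mul, gaussianReal_map_add_const] at this
    rw [Function.comp_def] at this
    rw [← this]
    congr 1
    · simp
    · ext
      simp [sq_nonneg]
  unfold gaussParams
  simp_rw [h]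
  exact (Measure.pi_map_pi (μ := fun _ => gaussianReal 0 1) (f := fun j t => σ * t + μ j)
    (hμ := fun j => by rw [← h]; infer_instance) (fun j => by fun_prop)).symm

/-- A quadratic polynomial in the `ℓ¹` norm of a standard Gaussian vector is square integrable. -/
lemma integrable_sq_quadratic_sum_abs {ι : Type*} [Fintype ι] (a b : ℝ) :
    Integrable (fun z : ι → ℝ => ((∑ j, |z j|) * (a * (b + ∑ j, |z j|) + 1)) ^ 2)
      (Measure.pi fun _ : ι => gaussianReal 0 1) := by
  have hS : MemLp (fun z : ι → ℝ => ∑ j, |z j|) 4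
      (Measure.pi fun _ : ι => gaussianReal 0 1) := by
    refine memLp_finsetSum _ fun j _ => ?_
    have h : MemLp (fun t : ℝ => t) 4 (gaussianReal 0 1) :=
      memLp_id_gaussianReal (μ := 0) (v := 1) 4
    exact (h.comp_measurePreserving
      (measurePreserving_eval (fun _ : ι => gaussianReal 0 1) j)).norm
  have hS2 : MemLp (fun z : ι → ℝ => (∑ j, |z j|) ^ 2) 2
      (Measure.pi fun _ : ι => gaussianReal 0 1) := by
    refine (memLp_two_iff_integrable_sq (hS.aestronglyMeasurable.pow 2)).mpr ((hS.integrable_norm_pow (p := 4) (by norm_num)).congr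
      (ae_of_all _ fun z => ?_))
    simp only [Real.norm_eq_abs, Pi.pow_apply]
    rw [Even.pow_abs (by decide), ← pow_mul]
  have hP := ((hS2.const_mul a).add
    ((hS.mono_exponent (p := 2) (by norm_num)).const_mul (a * b + 1))).integrable_sq
  refine hP.congr (ae_of_all _ fun z => ?_)
  simp only [Pi.add_apply]
  ring

/-- For a single-hidden-layer ReLU network whose parameters are mutually
independent Gaussians with fixed means `μ` and shared standard deviation `σ`, for every
compact `A` and `ε > 0` there is `σ' > 0` such that for all `0 < σ < σ'` and all `x ∈ A`,
`Var[ψ(f^(k)_θ(x))] < ε` for every `k`. -/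
theorem variance_small_of_small_sd (D I K : ℕ) (μ : ParamIdx D I K → ℝ)
    (A : Set (Fin D → ℝ)) (hA : IsCompact A) (ε : ℝ) (hε : 0 < ε) :
    ∃ σ' > (0 : ℝ), ∀ σ : ℝ, 0 < σ → σ < σ' → ∀ x ∈ A, ∀ k : Fin K,
      variance (fun θ => max 0 (net1 θ x k)) (gaussParams μ σ) < ε := by
  obtain ⟨R₀, hR₀⟩ := hA.isBounded.exists_norm_le
  set R := max R₀ 0
  set M := ∑ j, |μ j|
  set P : (ParamIdx D I K → ℝ) → ℝ := fun z =>
    (∑ j, |z j|) * (I * (R + 1) * (2 * M + ∑ j, |z j|) + 1)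
  set ν : Measure (ParamIdx D I K → ℝ) := Measure.pi fun _ => gaussianReal 0 1
  have hR : 0 ≤ R := le_max_right _ _
  have hM : 0 ≤ M := Finset.sum_nonneg fun _ _ => abs_nonneg _
  have hP : Integrable (fun z => P z ^ 2) ν := integrable_sq_quadratic_sum_abs _ _
  have hC : 0 ≤ ∫ z, P z ^ 2 ∂ν := integral_nonneg fun _ => sq_nonneg _
  refine ⟨min 1 (ε / (∫ z, P z ^ 2 ∂ν + 1)), lt_min one_pos (by positivity), ?_⟩
  intro σ hσ hσ' x hx k
  obtain ⟨hσ1, hσε⟩ := lt_min_iff.mp hσ'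
  have hxR : ∀ d, |x d| ≤ R := fun d =>
    (norm_le_pi_norm x d).trans ((hR₀ x hx).trans (le_max_left _ _))
  have hcont : Continuous fun θ : ParamIdx D I K → ℝ => max 0 (net1 θ x k) := by
    unfold net1
    fun_prop
  have hbound : ∀ z : ParamIdx D I K → ℝ,
      (max 0 (net1 (fun j => σ * z j + μ j) x k) - max 0 (net1 μ x k)) ^ 2 ≤
        σ ^ 2 * P z ^ 2 := fun z => by
    have h := abs_net1_sub_le (fun j => σ * z j + μ j) μ x hR hxR k
    simp only [add_sub_cancel_right, abs_mul, abs_of_pos hσ, ← Finset.mul_sum] at h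
    have hS : 0 ≤ ∑ j, |z j| := Finset.sum_nonneg fun _ _ => abs_nonneg _
    rw [← mul_pow, sq_le_sq]
    refine (abs_max_zero_sub_max_zero_le _ _).trans (h.trans (le_trans ?_ (le_abs_self _)))
    change _ ≤ σ * ((∑ j, |z j|) * (I * (R + 1) * (2 * M + ∑ j, |z j|) + 1))
    rw [mul_assoc σ, mul_assoc (I : ℝ)]
    have := mul_le_of_le_one_left hS hσ1.le
    gcongr
  have hmap : Measurable fun (z : ParamIdx D I K → ℝ) j => σ * z j + μ j := by fun_prop
  rw [gaussParams_eq_map]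
  have : IsProbabilityMeasure (ν.map fun z j => σ * z j + μ j) :=
    Measure.isProbabilityMeasure_map hmap.aemeasurable
  calc variance (fun θ => max 0 (net1 θ x k)) (ν.map fun z j => σ * z j + μ j)
      = variance (fun θ => max 0 (net1 θ x k) - max 0 (net1 μ x k))
          (ν.map fun z j => σ * z j + μ j) :=
        (variance_sub_const hcont.aestronglyMeasurable _).symm
    _ ≤ ∫ θ, (max 0 (net1 θ x k) - max 0 (net1 μ x k)) ^ 2
          ∂(ν.map fun z j => σ * z j + μ j) :=
        variance_le_expectation_sq (hcont.sub continuous_const).aestronglyMeasurable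
    _ = ∫ z, (max 0 (net1 (fun j => σ * z j + μ j) x k) - max 0 (net1 μ x k)) ^ 2 ∂ν :=
        integral_map hmap.aemeasurable
          ((hcont.sub continuous_const).pow 2).aestronglyMeasurable
    _ ≤ ∫ z, σ ^ 2 * P z ^ 2 ∂ν :=
        integral_mono_of_nonneg (ae_of_all _ fun _ => sq_nonneg _) (hP.const_mul _)
          (ae_of_all _ hbound)
    _ = σ ^ 2 * ∫ z, P z ^ 2 ∂ν := integral_const_mul _ _
    _ < ε := by
        rw [lt_div_iff₀ (by positivity)] at hσε
        nlinarith [mul_nonneg (mul_nonneg hσ.le (sub_nonneg.mpr hσ1.le)) hC]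
end

section
/- Let N(r) = (2π)^{−1/2} e^{−r²/2} be the standard Gaussian pdf and Φ(r) = ∫_{−∞}^r N(t) dt the standard Gaussian cdf. Then for all r > 0, −Φ(r) + N(r)² + r N(r) Φ(r) < 0. Consequently, with h(r) = N(r) + rΦ(r), α(r) = Φ(r) + r·h(r) − h(r)², and β(r) = α(r)/r², the derivative β'(r) = (−2Φ(r) + 2N(r)² + 2rN(r)Φ(r))/r³ is strictly negative for all r > 0. -/
open Real

/-- The standard Gaussian probability density function. -/
noncomputable def stdGaussPdf (r : ℝ) : ℝ := (Real.sqrt (2 * Real.pi))⁻¹ * Real.exp (-r ^ 2 / 2)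

/-- The standard Gaussian cumulative distribution function. -/
noncomputable def stdGaussCdf (r : ℝ) : ℝ := ∫ t in Set.Iic r, stdGaussPdf t

/-- `h(r) = N(r) + r Φ(r)`. -/
noncomputable def hFun (r : ℝ) : ℝ := stdGaussPdf r + r * stdGaussCdf r

/-- `α(r) = Φ(r) + r h(r) - h(r)²`. -/
noncomputable def alphaFun (r : ℝ) : ℝ := stdGaussCdf r + r * hFun r - (hFun r) ^ 2

/-- `β(r) = α(r) / r²`. -/
noncomputable def betaFun (r : ℝ) : ℝ := alphaFun r / r ^ 2

theorem continuous_stdGaussPdf : Continuous stdGaussPdf := by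
  unfold stdGaussPdf
  fun_prop

theorem stdGaussPdf_pos (r : ℝ) : 0 < stdGaussPdf r := by
  unfold stdGaussPdf
  positivity

theorem integrable_stdGaussPdf : MeasureTheory.Integrable stdGaussPdf := by
  have h := (integrable_exp_neg_mul_sq (b := 1 / 2) (by norm_num)).const_mul (√(2 * π))⁻¹
  convert h using 2 with x
  unfold stdGaussPdf
  ring_nf

theorem hasDerivAt_stdGaussPdf (r : ℝ) : HasDerivAt stdGaussPdf (-r * stdGaussPdf r) r := by
  have h : HasDerivAt (fun x : ℝ => -x ^ 2 / 2) (-r) r := by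
    refine ((hasDerivAt_pow 2 r).neg.div_const 2).congr_deriv ?_
    push_cast
    ring
  refine (h.exp.const_mul (√(2 * π))⁻¹).congr_deriv ?_
  unfold stdGaussPdf
  ring

theorem stdGaussCdf_eq_add (r : ℝ) :
    stdGaussCdf r = stdGaussCdf 0 + ∫ t in (0 : ℝ)..r, stdGaussPdf t := by
  have h := intervalIntegral.integral_Iic_sub_Iic (a := 0) (b := r)
    integrable_stdGaussPdf.integrableOn integrable_stdGaussPdf.integrableOn
  unfold stdGaussCdf
  linarith

theorem hasDerivAt_stdGaussCdf (r : ℝ) : HasDerivAt stdGaussCdf (stdGaussPdf r) r := by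
  rw [funext stdGaussCdf_eq_add]
  exact (continuous_stdGaussPdf.integral_hasStrictDerivAt 0 r).hasDerivAt.const_add _

theorem stdGaussCdf_zero : stdGaussCdf 0 = 1 / 2 := by
  have h := integral_gaussian_Ioi (1 / 2)
  have hneg := integral_comp_neg_Iic 0 stdGaussPdf
  have heven : ∀ x, stdGaussPdf (-x) = stdGaussPdf x := fun x => by simp [stdGaussPdf]
  simp only [heven, neg_zero] at hneg
  have hexp : ∀ x : ℝ, -x ^ 2 / 2 = -(1 / 2) * x ^ 2 := fun x => by ring
  unfold stdGaussCdf
  rw [hneg]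
  simp only [stdGaussPdf, hexp]
  rw [MeasureTheory.integral_const_mul, h, show π / (1 / 2) = 2 * π by ring]
  field_simp

theorem half_le_stdGaussCdf {r : ℝ} (hr : 0 ≤ r) : 1 / 2 ≤ stdGaussCdf r := by
  rw [stdGaussCdf_eq_add, stdGaussCdf_zero]
  have := intervalIntegral.integral_nonneg (μ := MeasureTheory.volume) hr fun t _ => (stdGaussPdf_pos t).le
  linarith

theorem inv_sqrt_two_pi_lt_half : (√(2 * π))⁻¹ < 1 / 2 := by
  rw [one_div]
  apply inv_strictAnti₀ (by norm_num)
  apply Real.lt_sqrt_of_sq_lt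
  linarith [Real.pi_gt_three]

theorem stdGaussPdf_lt_half (r : ℝ) : stdGaussPdf r < 1 / 2 := by
  refine lt_of_le_of_lt ?_ inv_sqrt_two_pi_lt_half
  refine mul_le_of_le_one_right (by positivity) (Real.exp_le_one_iff.2 ?_)
  nlinarith [sq_nonneg r]

theorem mul_stdGaussPdf_lt_half (r : ℝ) : r * stdGaussPdf r < 1 / 2 := by
  refine lt_of_le_of_lt ?_ inv_sqrt_two_pi_lt_half
  have h : r * Real.exp (-r ^ 2 / 2) ≤ 1 := by
    rw [neg_div, Real.exp_neg, ← div_eq_mul_inv, div_le_one (Real.exp_pos _)]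
    nlinarith [Real.add_one_le_exp (r ^ 2 / 2), sq_nonneg (r - 1)]
  calc r * stdGaussPdf r = (√(2 * π))⁻¹ * (r * Real.exp (-r ^ 2 / 2)) := by
        unfold stdGaussPdf
        ring
    _ ≤ (√(2 * π))⁻¹ := mul_le_of_le_one_right (by positivity) h

theorem neg_stdGaussCdf_add_lt_zero {r : ℝ} (hr : 0 ≤ r) :
    -stdGaussCdf r + stdGaussPdf r ^ 2 + r * stdGaussPdf r * stdGaussCdf r < 0 := by
  have hΦ := half_le_stdGaussCdf hr
  have hrN := mul_stdGaussPdf_lt_half r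
  have hN : stdGaussPdf r ^ 2 < 1 / 4 := by
    nlinarith [stdGaussPdf_lt_half r, stdGaussPdf_pos r]
  nlinarith [mul_le_mul_of_nonneg_left hΦ (sub_nonneg.2 hrN.le)]

theorem hasDerivAt_hFun (r : ℝ) : HasDerivAt hFun (stdGaussCdf r) r := by
  refine ((hasDerivAt_stdGaussPdf r).add
    ((hasDerivAt_id r).mul (hasDerivAt_stdGaussCdf r))).congr_deriv ?_
  simp

theorem hasDerivAt_alphaFun (r : ℝ) :
    HasDerivAt alphaFun
      (stdGaussPdf r + (hFun r + r * stdGaussCdf r) - 2 * hFun r * stdGaussCdf r) r := by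
  refine (((hasDerivAt_stdGaussCdf r).add ((hasDerivAt_id r).mul (hasDerivAt_hFun r))).sub
    ((hasDerivAt_hFun r).pow 2)).congr_deriv ?_
  simp

theorem hasDerivAt_betaFun {r : ℝ} (hr : r ≠ 0) :
    HasDerivAt betaFun
      ((-2 * stdGaussCdf r + 2 * stdGaussPdf r ^ 2 + 2 * r * stdGaussPdf r * stdGaussCdf r)
        / r ^ 3) r := by
  refine ((hasDerivAt_alphaFun r).div (hasDerivAt_pow 2 r) (pow_ne_zero 2 hr)).congr_deriv ?_
  unfold alphaFun hFun
  field_simp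
  push_cast
  ring

/-- For all `r > 0`, `-Φ(r) + N(r)² + r N(r) Φ(r) < 0`; consequently
`β'(r) = (-2Φ(r) + 2N(r)² + 2 r N(r) Φ(r)) / r³` is strictly negative for all `r > 0`. -/
theorem betaFun_deriv_neg :
    ∀ r : ℝ, 0 < r →
      (-stdGaussCdf r + (stdGaussPdf r) ^ 2 + r * stdGaussPdf r * stdGaussCdf r < 0) ∧
      deriv betaFun r =
        (-2 * stdGaussCdf r + 2 * (stdGaussPdf r) ^ 2 + 2 * r * stdGaussPdf r * stdGaussCdf r)
          / r ^ 3 ∧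
      deriv betaFun r < 0 := by
  intro r hr
  have h := neg_stdGaussCdf_add_lt_zero hr.le
  have hderiv := (hasDerivAt_betaFun hr.ne').deriv
  refine ⟨h, hderiv, ?_⟩
  rw [hderiv]
  exact div_neg_of_neg_of_pos (by linarith) (by positivity)
end
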